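/- Let n ≥ 3 and i ∈ {1,…,n}. There is a constant C = C(n) such that for all ν ≥ 0, all k ∈ ℤⁿ, and all u₀ ∈ L¹(ℝⁿ) whose Fourier transform is supported in {ξ : |ξ_j - k_j| ≤ 1 for all j}, one has ∫_ℝ sup_{t ≥ 0, x̄ ∈ ℝ^{n-1}} |(G_ν(t)u₀)(x)| dx_i ≤ C (1+|k_i|) ‖u₀‖_{L¹(ℝⁿ)}, where x̄ denotes the variables x_j with j ≠ i. -/

import Mathlib

open MeasureTheory

noncomputable section

/-- `e r = exp (i r)`. -/
def e (r : ℝ) : ℂ := Complex.exp (Complex.I * (r : ℂ))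

/-- Insert the value `a` in the `i`-th coordinate of `y : ℝ^{n-1}` to get a point of `ℝⁿ`. -/
def embed {n : ℕ} (i : Fin n) (a : ℝ) (y : {j : Fin n // j ≠ i} → ℝ) : Fin n → ℝ :=
  fun j => if h : j = i then a else y ⟨j, h⟩

/-- The Fourier transform: `𝓕 f (ξ) = ∫ e^{-ix·ξ} f x dx`. -/
def FT {n : ℕ} (f : (Fin n → ℝ) → ℂ) (ξ : Fin n → ℝ) : ℂ :=
  ∫ x : Fin n → ℝ, e (-(∑ j, x j * ξ j)) * f x

/-- The Ginzburg–Landau semigroup `G_ν(t) f = 𝓕⁻¹(e^{-it|ξ|² - νt|ξ|²} 𝓕f)`. -/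
def Gnu {n : ℕ} (ν : ℝ) (f : (Fin n → ℝ) → ℂ) (t : ℝ) (x : Fin n → ℝ) : ℂ :=
  ((2 * Real.pi) ^ n)⁻¹ •
    ∫ ξ : Fin n → ℝ,
      e ((∑ j, x j * ξ j) - t * (∑ j, ξ j ^ 2)) *
        (Real.exp (-(ν * t * (∑ j, ξ j ^ 2))) : ℂ) * FT f ξ

open scoped SchwartzMap FourierTransform

/-- The oscillating Gaussian `e^{ixξ - zξ²}`. -/
def oscGauss (z : ℂ) (x ξ : ℝ) : ℂ :=
  Complex.exp (Complex.I * x * ξ) * Complex.exp (-z * (ξ : ℂ) ^ 2)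

/-- The one-dimensional kernel `∫ e^{ixξ - zξ²} φ(ξ - k) dξ`. -/
def cutoffKernel (φ : 𝓢(ℝ, ℂ)) (k : ℝ) (z : ℂ) (x : ℝ) : ℂ :=
  ∫ ξ : ℝ, oscGauss z x ξ * φ (ξ - k)

theorem continuous_oscGauss (z : ℂ) (x : ℝ) : Continuous (oscGauss z x) := by
  unfold oscGauss; fun_prop

theorem norm_oscGauss (z : ℂ) (x ξ : ℝ) : ‖oscGauss z x ξ‖ = Real.exp (-z.re * ξ ^ 2) := by
  have h : Complex.I * x * ξ = ((x * ξ : ℝ) : ℂ) * Complex.I := by push_cast; ring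
  rw [oscGauss, norm_mul, norm_cexp_neg_mul_sq, h, Complex.norm_exp_ofReal_mul_I, one_mul]

theorem norm_oscGauss_le_one {z : ℂ} (hz : 0 ≤ z.re) (x ξ : ℝ) : ‖oscGauss z x ξ‖ ≤ 1 := by
  rw [norm_oscGauss, Real.exp_le_one_iff]
  nlinarith [mul_nonneg hz (sq_nonneg ξ)]

theorem hasDerivAt_oscGauss (z : ℂ) (x ξ : ℝ) :
    HasDerivAt (oscGauss z x) ((Complex.I * x - 2 * z * ξ) * oscGauss z x ξ) ξ := by
  have h1 : HasDerivAt (fun ξ : ℝ => (ξ : ℂ)) 1 ξ := Complex.ofRealCLM.hasDerivAt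
  have h := ((h1.const_mul (Complex.I * x)).cexp).mul (((h1.pow 2).const_mul (-z)).cexp)
  refine h.congr_deriv ?_
  simp only [oscGauss, Pi.pow_apply]
  push_cast
  ring

theorem integrable_oscGauss_mul {z : ℂ} (hz : 0 ≤ z.re) (x : ℝ) {f : ℝ → ℂ} (hf : Integrable f) :
    Integrable fun ξ => oscGauss z x ξ * f ξ :=
  hf.bdd_mul (c := 1) (continuous_oscGauss z x).aestronglyMeasurable
    (.of_forall (norm_oscGauss_le_one hz x))

theorem norm_cutoffKernel_le_integral (φ : 𝓢(ℝ, ℂ)) (k : ℝ) {z : ℂ} (hz : 0 ≤ z.re) (x : ℝ) :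
    ‖cutoffKernel φ k z x‖ ≤ ∫ ξ, ‖φ ξ‖ := by
  rw [← integral_sub_right_eq_self (fun ξ => ‖φ ξ‖) k]
  refine norm_integral_le_of_norm_le (φ.integrable.norm.comp_sub_right k) (.of_forall fun ξ => ?_)
  rw [norm_mul]
  exact mul_le_of_le_one_left (norm_nonneg _) (norm_oscGauss_le_one hz x ξ)

theorem apply_eq_integral_fourier (φ : 𝓢(ℝ, ℂ)) (ξ : ℝ) :
    φ ξ = ∫ v : ℝ, Complex.exp (Complex.I * ((2 * Real.pi * v : ℝ) : ℂ) * ξ) * (𝓕 φ) v := by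
  have h := congrFun (φ.continuous.fourierInv_fourier_eq φ.integrable
    (by rw [← SchwartzMap.fourier_coe]; exact (𝓕 φ).integrable)) ξ
  rw [← h, Real.fourierInv_eq', ← SchwartzMap.fourier_coe]
  congr 1 with v
  rw [smul_eq_mul]
  congr 2
  simp
  ring

/-- The dispersive bound when the Gaussian is integrable. -/
theorem norm_cutoffKernel_le_of_re_pos (φ : 𝓢(ℝ, ℂ)) (k : ℝ) {z : ℂ} (hz : 0 < z.re) (x : ℝ) :
    ‖cutoffKernel φ k z x‖ ≤ Real.sqrt (Real.pi / ‖z‖) * ∫ v, ‖(𝓕 φ) v‖ := by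
  have hz0 : z ≠ 0 := fun h => by simp [h] at hz
  set F : ℝ → ℝ → ℂ := fun ξ v => oscGauss z x ξ *
    (Complex.exp (Complex.I * ((2 * Real.pi * v : ℝ) : ℂ) * ((ξ - k : ℝ) : ℂ)) * (𝓕 φ) v) with hF
  have hunit : ∀ a b : ℝ, ‖Complex.exp (Complex.I * (a : ℂ) * (b : ℂ))‖ = 1 := fun a b => by
    rw [show Complex.I * (a : ℂ) * (b : ℂ) = ((a * b : ℝ) : ℂ) * Complex.I by push_cast; ring,
      Complex.norm_exp_ofReal_mul_I]
  have hG : Integrable (oscGauss z x) := by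
    refine (integrable_cexp_neg_mul_sq hz).bdd_mul (c := 1)
      (Continuous.aestronglyMeasurable (by fun_prop)) (.of_forall fun ξ => (hunit x ξ).le)
  have hint : Integrable (Function.uncurry F) (volume.prod volume) := by
    have h := (hG.mul_prod (𝓕 φ).integrable (ν := volume)).bdd_mul (c := 1)
      (f := fun p : ℝ × ℝ =>
        Complex.exp (Complex.I * ((2 * Real.pi * p.2 : ℝ) : ℂ) * ((p.1 - k : ℝ) : ℂ)))
      (Continuous.aestronglyMeasurable (by fun_prop)) (.of_forall fun p => (hunit _ _).le)
    refine h.congr (.of_forall fun p => ?_)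
    simp only [hF, Function.uncurry]
    ring
  have hK : cutoffKernel φ k z x = ∫ v, ∫ ξ, F ξ v := by
    rw [← integral_integral_swap hint]
    unfold cutoffKernel
    congr 1 with ξ
    rw [hF, integral_const_mul, ← apply_eq_integral_fourier]
  have hinner : ∀ v, ‖∫ ξ, F ξ v‖ ≤ Real.sqrt (Real.pi / ‖z‖) * ‖(𝓕 φ) v‖ := fun v => by
    have h1 : ∀ ξ : ℝ, F ξ v =
        (Complex.exp (Complex.I * ((2 * Real.pi * v : ℝ) : ℂ) * ((-k : ℝ) : ℂ)) * (𝓕 φ) v) *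
        (Complex.exp (Complex.I * ((x + 2 * Real.pi * v : ℝ) : ℂ) * ξ) *
          Complex.exp (-z * (ξ : ℂ) ^ 2)) := fun ξ => by
      have h2 : Complex.exp (Complex.I * x * ξ) *
          Complex.exp (Complex.I * ((2 * Real.pi * v : ℝ) : ℂ) * ((ξ - k : ℝ) : ℂ)) =
          Complex.exp (Complex.I * ((2 * Real.pi * v : ℝ) : ℂ) * ((-k : ℝ) : ℂ)) *
          Complex.exp (Complex.I * ((x + 2 * Real.pi * v : ℝ) : ℂ) * ξ) := by
        rw [← Complex.exp_add, ← Complex.exp_add]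
        congr 1
        push_cast
        ring
      simp only [hF, oscGauss]
      linear_combination (Complex.exp (-z * (ξ : ℂ) ^ 2) * (𝓕 φ) v) * h2
    simp_rw [h1]
    rw [integral_const_mul, fourierIntegral_gaussian hz, norm_mul, norm_mul, norm_mul, hunit,
      one_mul, mul_comm]
    refine mul_le_mul_of_nonneg_right ?_ (norm_nonneg _)
    have hpow : ‖((Real.pi : ℂ) / z) ^ (1 / 2 : ℂ)‖ = Real.sqrt (Real.pi / ‖z‖) := by
      have h3 : (1 / 2 : ℂ) = ((1 / 2 : ℝ) : ℂ) := by push_cast; rfl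
      rw [h3, Complex.norm_cpow_of_ne_zero (by simp [Real.pi_ne_zero, hz0])]
      simp [Real.sqrt_eq_rpow, abs_of_pos Real.pi_pos]
    rw [hpow]
    refine mul_le_of_le_one_right (Real.sqrt_nonneg _) ?_
    rw [Complex.norm_exp, Real.exp_le_one_iff]
    have : (-((x + 2 * Real.pi * v : ℝ) : ℂ) ^ 2 / (4 * z)) =
        ((-(x + 2 * Real.pi * v) ^ 2 / 4 : ℝ) : ℂ) * z⁻¹ := by
      push_cast; field_simp
    rw [this, Complex.re_ofReal_mul, Complex.inv_re]
    refine mul_nonpos_of_nonpos_of_nonneg ?_ (div_nonneg hz.le (Complex.normSq_nonneg _))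
    nlinarith [sq_nonneg (x + 2 * Real.pi * v)]
  rw [hK, ← integral_const_mul]
  exact norm_integral_le_of_norm_le ((𝓕 φ).integrable.norm.const_mul _) (.of_forall hinner)

theorem norm_cutoffKernel_le_sqrt (φ : 𝓢(ℝ, ℂ)) (k : ℝ) {z : ℂ} (hz : 0 ≤ z.re) (hz0 : z ≠ 0)
    (x : ℝ) :
    ‖cutoffKernel φ k z x‖ ≤ Real.sqrt (Real.pi / ‖z‖) * ∫ v, ‖(𝓕 φ) v‖ := by
  have hlim : Filter.Tendsto (fun ε : ℝ => cutoffKernel φ k (z + ε) x)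
      (nhdsWithin 0 (Set.Ioi 0)) (nhds (cutoffKernel φ k z x)) := by
    refine tendsto_integral_filter_of_dominated_convergence (fun ξ => ‖φ (ξ - k)‖)
      (.of_forall fun ε => ?_) ?_ (φ.integrable.norm.comp_sub_right k) (.of_forall fun ξ => ?_)
    · exact ((continuous_oscGauss _ _).mul
        (φ.continuous.comp (continuous_sub_right k))).aestronglyMeasurable
    · filter_upwards [self_mem_nhdsWithin] with ε hε
      refine .of_forall fun ξ => ?_
      rw [norm_mul]
      refine mul_le_of_le_one_left (norm_nonneg _) (norm_oscGauss_le_one ?_ x ξ)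
      simpa using add_nonneg hz (le_of_lt hε)
    · have hc : Continuous fun ε : ℝ => oscGauss (z + ε) x ξ * φ (ξ - k) := by
        unfold oscGauss; fun_prop
      simpa using (hc.tendsto 0).mono_left nhdsWithin_le_nhds
  refine le_of_tendsto hlim.norm ?_
  filter_upwards [self_mem_nhdsWithin] with ε hε
  have hε' : (0 : ℝ) < ε := hε
  refine (norm_cutoffKernel_le_of_re_pos φ k (by simp; linarith) x).trans ?_
  have hle : ‖z‖ ≤ ‖z + ε‖ := by
    rw [Complex.norm_def, Complex.norm_def]
    refine Real.sqrt_le_sqrt ?_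
    simp only [Complex.normSq_apply, Complex.add_re, Complex.ofReal_re, Complex.add_im,
      Complex.ofReal_im, add_zero]
    nlinarith
  have hpos : 0 < ‖z‖ := norm_pos_iff.2 hz0
  refine mul_le_mul_of_nonneg_right (Real.sqrt_le_sqrt ?_)
    (integral_nonneg fun _ => norm_nonneg _)
  exact div_le_div_of_nonneg_left Real.pi_pos.le hpos hle

/-- Dispersive decay, uniformly in the frequency `k`. -/
theorem exists_norm_cutoffKernel_le_rpow (φ : 𝓢(ℝ, ℂ)) :
    ∃ C : ℝ, ∀ (k : ℝ) (z : ℂ), 0 ≤ z.re → ∀ x : ℝ,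
      ‖cutoffKernel φ k z x‖ ≤ C * (1 + ‖z‖) ^ (-(1 / 2) : ℝ) := by
  refine ⟨(∫ ξ, ‖φ ξ‖) + Real.sqrt Real.pi * ∫ v, ‖(𝓕 φ) v‖, fun k z hz x => ?_⟩
  have hp : (0 : ℝ) < 1 + ‖z‖ := by positivity
  rw [Real.rpow_neg hp.le, ← Real.sqrt_eq_rpow, ← div_eq_mul_inv, le_div_iff₀ (Real.sqrt_pos.2 hp)]
  have h1 := norm_cutoffKernel_le_integral φ k hz x
  have h2 : ‖cutoffKernel φ k z x‖ * Real.sqrt ‖z‖ ≤ Real.sqrt Real.pi * ∫ v, ‖(𝓕 φ) v‖ := by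
    rcases eq_or_ne z 0 with rfl | hz0
    · simp only [norm_zero, Real.sqrt_zero, mul_zero]
      exact mul_nonneg (Real.sqrt_nonneg _) (integral_nonneg fun _ => norm_nonneg _)
    · have hs : 0 < Real.sqrt ‖z‖ := Real.sqrt_pos.2 (norm_pos_iff.2 hz0)
      have h := norm_cutoffKernel_le_sqrt φ k hz hz0 x
      rw [Real.sqrt_div Real.pi_pos.le, div_mul_eq_mul_div, le_div_iff₀ hs] at h
      exact h
  have h3 : Real.sqrt (1 + ‖z‖) ≤ 1 + Real.sqrt ‖z‖ :=
    Real.sqrt_le_iff.2 ⟨by positivity,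
      by nlinarith [Real.sq_sqrt (norm_nonneg z), Real.sqrt_nonneg ‖z‖]⟩
  nlinarith [mul_le_mul_of_nonneg_left h3 (norm_nonneg (cutoffKernel φ k z x))]

/-- Two integrations by parts: decay away from the stationary point. -/
theorem exists_norm_cutoffKernel_le_of_nonstationary (φ : 𝓢(ℝ, ℂ))
    (hφ : ∀ ξ : ℝ, 2 ≤ |ξ| → φ ξ = 0) :
    ∃ C : ℝ, ∀ (k : ℝ) (z : ℂ), 0 ≤ z.re → ∀ x : ℝ, 12 * (1 + |k|) * ‖z‖ ≤ |x| →
      ‖cutoffKernel φ k z x‖ ≤ C * (1 + |x|) ^ (-(3 / 2) : ℝ) := by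
  set φ₁ := SchwartzMap.derivCLM ℂ ℂ φ with hφ₁
  set φ₂ := SchwartzMap.derivCLM ℂ ℂ φ₁ with hφ₂
  have hd : ∀ ψ : 𝓢(ℝ, ℂ), ∀ ξ, HasDerivAt ψ (SchwartzMap.derivCLM ℂ ℂ ψ ξ) ξ := fun ψ ξ =>
    ψ.differentiableAt.hasDerivAt
  obtain ⟨M, hM0, hM⟩ : ∃ M : ℝ, 0 ≤ M ∧ ∀ ξ, ‖φ ξ‖ ≤ M ∧ ‖φ₁ ξ‖ ≤ M ∧ ‖φ₂ ξ‖ ≤ M := by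
    have hb := fun (ψ : 𝓢(ℝ, ℂ)) ξ => SchwartzMap.norm_le_seminorm ℂ ψ ξ
    refine ⟨SchwartzMap.seminorm ℂ 0 0 φ + SchwartzMap.seminorm ℂ 0 0 φ₁ +
      SchwartzMap.seminorm ℂ 0 0 φ₂, by positivity, fun ξ => ?_⟩
    have h0 := (norm_nonneg _).trans (hb φ 0)
    have h1 := (norm_nonneg _).trans (hb φ₁ 0)
    have h2 := (norm_nonneg _).trans (hb φ₂ 0)
    exact ⟨by linarith [hb φ ξ], by linarith [hb φ₁ ξ], by linarith [hb φ₂ ξ]⟩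
  have hφ₁0 : ∀ ξ : ℝ, 2 < |ξ| → φ₁ ξ = 0 := fun ξ hξ => by
    have : (φ : ℝ → ℂ) =ᶠ[nhds ξ] fun _ => 0 := by
      filter_upwards [(isOpen_lt continuous_const continuous_abs).mem_nhds hξ] with η hη
      exact hφ η (le_of_lt hη)
    rw [hφ₁, SchwartzMap.derivCLM_apply, this.deriv_eq, deriv_const]
  -- the bound for `1 ≤ |x|`
  have key : ∀ (k : ℝ) (z : ℂ), 0 ≤ z.re → ∀ x : ℝ, 12 * (1 + |k|) * ‖z‖ ≤ |x| → 1 ≤ |x| →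
      ‖cutoffKernel φ k z x‖ ≤ 19 * M * 4 / x ^ 2 * 6 := by
    intro k z hz x hxz hx
    set D : ℝ → ℂ := fun ξ => Complex.I * x - 2 * z * ξ with hD
    have hDd : ∀ ξ, HasDerivAt D (-(2 * z)) ξ := fun ξ => by
      have h1 : HasDerivAt (fun ξ : ℝ => (ξ : ℂ)) 1 ξ := Complex.ofRealCLM.hasDerivAt
      exact ((h1.const_mul (2 * z)).const_sub _).congr_deriv (by ring)
    have hDc : Continuous D := by fun_prop
    have huIcc : Set.uIcc (k - 3) (k + 3) = Set.Icc (k - 3) (k + 3) :=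
      Set.uIcc_of_le (by linarith)
    have hDlow : ∀ ξ ∈ Set.uIcc (k - 3) (k + 3), |x| / 2 ≤ ‖D ξ‖ := fun ξ hξ => by
      rw [huIcc] at hξ
      have hξk : |ξ| ≤ 3 * (1 + |k|) := by
        have := abs_nonneg k
        rw [abs_le]
        constructor <;> linarith [neg_abs_le k, le_abs_self k, hξ.1, hξ.2]
      have h1 : ‖Complex.I * x‖ - ‖2 * z * ξ‖ ≤ ‖D ξ‖ := norm_sub_norm_le _ _
      simp only [norm_mul, Complex.norm_I, one_mul, Complex.norm_real, Real.norm_eq_abs,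
        Complex.norm_ofNat] at h1
      nlinarith [mul_le_mul_of_nonneg_left hξk (norm_nonneg z)]
    have hD0 : ∀ ξ ∈ Set.uIcc (k - 3) (k + 3), D ξ ≠ 0 := fun ξ hξ h => by
      have := hDlow ξ hξ
      rw [h, norm_zero] at this
      linarith
    set R : ℝ → ℂ := fun ξ => φ₂ (ξ - k) / D ξ ^ 2 + 6 * z * φ₁ (ξ - k) / D ξ ^ 3 +
      12 * z ^ 2 * φ (ξ - k) / D ξ ^ 4 with hR
    set P : ℝ → ℂ := fun ξ => oscGauss z x ξ *
      (φ (ξ - k) / D ξ - φ₁ (ξ - k) / D ξ ^ 2 - 2 * z * φ (ξ - k) / D ξ ^ 3) with hP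
    have hPd : ∀ ξ ∈ Set.uIcc (k - 3) (k + 3),
        HasDerivAt P (oscGauss z x ξ * φ (ξ - k) - oscGauss z x ξ * R ξ) ξ := fun ξ hξ => by
      have hne := hD0 ξ hξ
      have h0 : HasDerivAt (fun ξ => φ (ξ - k)) (φ₁ (ξ - k)) ξ := (hd φ (ξ - k)).comp_sub_const ξ k
      have h1 : HasDerivAt (fun ξ => φ₁ (ξ - k)) (φ₂ (ξ - k)) ξ :=
        (hd φ₁ (ξ - k)).comp_sub_const ξ k
      have h := (hasDerivAt_oscGauss z x ξ).mul
        (((h0.div (hDd ξ) hne).sub (h1.div ((hDd ξ).pow 2) (pow_ne_zero 2 hne))).sub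
          ((h0.const_mul (2 * z)).div ((hDd ξ).pow 3) (pow_ne_zero 3 hne)))
      refine h.congr_deriv ?_
      simp only [Pi.sub_apply, Pi.div_apply, Pi.pow_apply, hR]
      rw [show Complex.I * x - 2 * z * ξ = D ξ from rfl]
      field_simp
      push_cast
      ring
    have hcφ : ∀ ψ : 𝓢(ℝ, ℂ), Continuous fun ξ => ψ (ξ - k) := fun ψ =>
      ψ.continuous.comp (continuous_sub_right k)
    have hGc := continuous_oscGauss z x
    have hRc : ContinuousOn R (Set.uIcc (k - 3) (k + 3)) := by
      refine ((ContinuousOn.div ?_ ?_ ?_).add (ContinuousOn.div ?_ ?_ ?_)).add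
        (ContinuousOn.div ?_ ?_ ?_)
      · exact (hcφ φ₂).continuousOn
      · exact (hDc.pow 2).continuousOn
      · exact fun ξ hξ => pow_ne_zero _ (hD0 ξ hξ)
      · exact (continuous_const.mul (hcφ φ₁)).continuousOn
      · exact (hDc.pow 3).continuousOn
      · exact fun ξ hξ => pow_ne_zero _ (hD0 ξ hξ)
      · exact (continuous_const.mul (hcφ φ)).continuousOn
      · exact (hDc.pow 4).continuousOn
      · exact fun ξ hξ => pow_ne_zero _ (hD0 ξ hξ)
    have hi1 : IntervalIntegrable (fun ξ => oscGauss z x ξ * φ (ξ - k)) volume (k - 3) (k + 3) :=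
      (hGc.mul (hcφ φ)).intervalIntegrable _ _
    have hi2 : IntervalIntegrable (fun ξ => oscGauss z x ξ * R ξ) volume (k - 3) (k + 3) :=
      (hGc.continuousOn.mul hRc).intervalIntegrable
    have hFTC := intervalIntegral.integral_eq_sub_of_hasDerivAt hPd (hi1.sub hi2)
    have h3 : (2 : ℝ) < |3| := by norm_num
    have h3' : (2 : ℝ) < |-3| := by norm_num
    have hPb : P (k + 3) = 0 := by
      simp [hP, hφ 3 h3.le, hφ₁0 3 h3]
    have hPa : P (k - 3) = 0 := by
      simp [hP, hφ (-3) h3'.le, hφ₁0 (-3) h3']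
    rw [intervalIntegral.integral_sub hi1 hi2, hPb, hPa, sub_zero, sub_eq_zero] at hFTC
    have hsupp : Function.support (fun ξ => oscGauss z x ξ * φ (ξ - k)) ⊆
        Set.Ioc (k - 3) (k + 3) := by
      intro ξ hξ
      have hlt : |ξ - k| < 2 := by
        by_contra hcon
        exact hξ (by simp [hφ _ (not_lt.1 hcon)])
      rw [abs_lt] at hlt
      constructor <;> linarith [hlt.1, hlt.2]
    have hK : cutoffKernel φ k z x = ∫ ξ in (k - 3)..(k + 3), oscGauss z x ξ * R ξ := by
      rw [← hFTC, intervalIntegral.integral_eq_integral_of_support_subset hsupp, cutoffKernel]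
    rw [hK]
    have hlen : |k + 3 - (k - 3)| = 6 := by
      rw [show k + 3 - (k - 3) = 6 by ring]; norm_num
    rw [← hlen]
    refine intervalIntegral.norm_integral_le_of_norm_le_const fun ξ hξ => ?_
    have hlow := hDlow ξ (Set.uIoc_subset_uIcc hξ)
    have hpos : 0 < ‖D ξ‖ := by linarith
    have hzD : ‖z‖ ≤ ‖D ξ‖ := by
      nlinarith [mul_nonneg (abs_nonneg k) (norm_nonneg z), norm_nonneg z]
    obtain ⟨m0, m1, m2⟩ := hM (ξ - k)
    have hr : ‖z‖ / ‖D ξ‖ ≤ 1 := (div_le_one hpos).2 hzD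
    have hr0 : 0 ≤ ‖z‖ / ‖D ξ‖ := by positivity
    have hRn : ‖R ξ‖ ≤ 19 * M / ‖D ξ‖ ^ 2 := by
      have e1 : ‖R ξ‖ ≤ ‖φ₂ (ξ - k)‖ / ‖D ξ‖ ^ 2 + 6 * ‖z‖ * ‖φ₁ (ξ - k)‖ / ‖D ξ‖ ^ 3 +
          12 * ‖z‖ ^ 2 * ‖φ (ξ - k)‖ / ‖D ξ‖ ^ 4 := by
        refine (norm_add₃_le).trans_eq ?_
        simp
      have e2 : ‖φ₂ (ξ - k)‖ / ‖D ξ‖ ^ 2 + 6 * ‖z‖ * ‖φ₁ (ξ - k)‖ / ‖D ξ‖ ^ 3 +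
          12 * ‖z‖ ^ 2 * ‖φ (ξ - k)‖ / ‖D ξ‖ ^ 4 =
          (‖φ₂ (ξ - k)‖ + 6 * ((‖z‖ / ‖D ξ‖) * ‖φ₁ (ξ - k)‖) +
            12 * ((‖z‖ / ‖D ξ‖) ^ 2 * ‖φ (ξ - k)‖)) / ‖D ξ‖ ^ 2 := by
        field_simp
      rw [e2] at e1
      refine e1.trans (div_le_div_of_nonneg_right ?_ (by positivity))
      have f1 : (‖z‖ / ‖D ξ‖) * ‖φ₁ (ξ - k)‖ ≤ 1 * M :=
        mul_le_mul hr m1 (norm_nonneg _) zero_le_one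
      have f2 : (‖z‖ / ‖D ξ‖) ^ 2 * ‖φ (ξ - k)‖ ≤ 1 * M :=
        mul_le_mul (pow_le_one₀ hr0 hr) m0 (norm_nonneg _) zero_le_one
      linarith
    rw [norm_mul]
    refine (mul_le_of_le_one_left (norm_nonneg _) (norm_oscGauss_le_one hz x ξ)).trans
      (hRn.trans ?_)
    have hx2 : 0 < x ^ 2 := by rw [← sq_abs]; positivity
    rw [div_le_div_iff₀ (by positivity) hx2]
    have : x ^ 2 ≤ 4 * ‖D ξ‖ ^ 2 := by
      rw [← sq_abs x]
      nlinarith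
    nlinarith
  refine ⟨4 * (∫ ξ, ‖φ ξ‖) + 19 * M * 4 * 6 * 4, fun k z hz x hxz => ?_⟩
  have hI : 0 ≤ ∫ ξ, ‖φ ξ‖ := integral_nonneg fun _ => norm_nonneg _
  have hp : (1 : ℝ) ≤ 1 + |x| := by linarith [abs_nonneg x]
  have hpow : ((1 + |x|) ^ 2)⁻¹ ≤ (1 + |x|) ^ (-(3 / 2) : ℝ) := by
    rw [← Real.rpow_natCast, ← Real.rpow_neg (by linarith)]
    exact Real.rpow_le_rpow_of_exponent_le hp (by norm_num)
  refine le_trans ?_ (mul_le_mul_of_nonneg_left hpow (by positivity))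
  rw [← div_eq_mul_inv, le_div_iff₀ (by positivity)]
  rcases le_total 1 |x| with hx | hx
  · have h := key k z hz x hxz hx
    have hx2 : 0 < x ^ 2 := by rw [← sq_abs]; positivity
    have h' : ‖cutoffKernel φ k z x‖ * x ^ 2 ≤ 19 * M * 4 * 6 := by
      rwa [div_mul_eq_mul_div, le_div_iff₀ hx2] at h
    have hq : (1 + |x|) ^ 2 ≤ 4 * x ^ 2 := by
      rw [← sq_abs x]; nlinarith
    nlinarith [mul_le_mul_of_nonneg_left hq (norm_nonneg (cutoffKernel φ k z x))]
  · have h := norm_cutoffKernel_le_integral φ k hz x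
    have hq : (1 + |x|) ^ 2 ≤ 4 := by nlinarith [abs_nonneg x]
    nlinarith [mul_le_mul_of_nonneg_left hq (norm_nonneg (cutoffKernel φ k z x))]

theorem exists_schwartzMap_cutoff :
    ∃ φ : 𝓢(ℝ, ℂ), (∀ ξ : ℝ, |ξ| ≤ 1 → φ ξ = 1) ∧ ∀ ξ : ℝ, 2 ≤ |ξ| → φ ξ = 0 := by
  let b : ContDiffBump (0 : ℝ) := ⟨1, 2, one_pos, one_lt_two⟩
  have hc : HasCompactSupport fun ξ : ℝ => ((b ξ : ℝ) : ℂ) :=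
    b.hasCompactSupport.comp_left (g := fun r : ℝ => (r : ℂ)) Complex.ofReal_zero
  refine ⟨hc.toSchwartzMap (Complex.ofRealCLM.contDiff.comp b.contDiff), fun ξ hξ => ?_,
    fun ξ hξ => ?_⟩
  · have : b ξ = 1 := b.one_of_mem_closedBall (by simpa [b] using hξ)
    change ((b ξ : ℝ) : ℂ) = 1
    simp [this]
  · have : b ξ = 0 := b.zero_of_le_dist (by simpa [b] using hξ)
    change ((b ξ : ℝ) : ℂ) = 0
    simp [this]

/-- The product kernel is dominated, uniformly in `z` and in the variables `x j` with `j ≠ i`, by an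
integrable function of `x i`. -/
theorem exists_norm_prod_cutoffKernel_le {n : ℕ} (hn : 3 ≤ n) (i : Fin n) (φ : 𝓢(ℝ, ℂ))
    (hφ : ∀ ξ : ℝ, 2 ≤ |ξ| → φ ξ = 0) :
    ∃ C : ℝ, 0 < C ∧ ∀ (k : Fin n → ℝ) (z : ℂ), 0 ≤ z.re → ∀ x : Fin n → ℝ,
      ‖∏ j, cutoffKernel φ (k j) z (x j)‖ ≤
        C * (1 + |x i / (12 * (1 + |k i|))|) ^ (-(3 / 2) : ℝ) := by
  obtain ⟨A, hA⟩ := exists_norm_cutoffKernel_le_rpow φ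
  obtain ⟨B, hB⟩ := exists_norm_cutoffKernel_le_of_nonstationary φ hφ
  set M := max (max A B) 1 with hM
  have hM1 : 1 ≤ M := le_max_right _ _
  have hAM : A ≤ M := (le_max_left _ _).trans (le_max_left _ _)
  have hBM : B ≤ M := (le_max_right _ _).trans (le_max_left _ _)
  refine ⟨M ^ n, by positivity, fun k z hz x => ?_⟩
  have hL : 1 ≤ 12 * (1 + |k i|) := by linarith [abs_nonneg (k i)]
  have hL0 : 0 < 12 * (1 + |k i|) := by linarith
  have hz1 : 1 ≤ 1 + ‖z‖ := by linarith [norm_nonneg z]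
  have hdisp : ∀ j, ‖cutoffKernel φ (k j) z (x j)‖ ≤ M * (1 + ‖z‖) ^ (-(1 / 2) : ℝ) := fun j =>
    (hA (k j) z hz (x j)).trans (mul_le_mul_of_nonneg_right hAM (by positivity))
  have hdecay : (1 + ‖z‖) ^ (-(1 / 2) : ℝ) ≤ 1 :=
    Real.rpow_le_one_of_one_le_of_nonpos hz1 (by norm_num)
  have hMj : ∀ j, ‖cutoffKernel φ (k j) z (x j)‖ ≤ M := fun j =>
    (hdisp j).trans (mul_le_of_le_one_right (by linarith) hdecay)
  rw [norm_prod, abs_div, abs_of_pos hL0]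
  rcases le_total (12 * (1 + |k i|) * ‖z‖) |x i| with h | h
  · have hxi := (hB (k i) z hz (x i) h).trans (mul_le_mul_of_nonneg_right hBM (by positivity))
    have hmono : (1 + |x i|) ^ (-(3 / 2) : ℝ) ≤
        (1 + |x i| / (12 * (1 + |k i|))) ^ (-(3 / 2) : ℝ) := by
      refine Real.rpow_le_rpow_of_nonpos (by positivity) ?_ (by norm_num)
      linarith [div_le_self (abs_nonneg (x i)) hL]
    rw [← Finset.mul_prod_erase _ _ (Finset.mem_univ i)]
    have hrest : ∏ j ∈ Finset.univ.erase i, ‖cutoffKernel φ (k j) z (x j)‖ ≤ M ^ (n - 1) := by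
      refine (Finset.prod_le_prod (fun _ _ => norm_nonneg _) (fun j _ => hMj j)).trans_eq ?_
      simp
    calc _ ≤ (M * (1 + |x i|) ^ (-(3 / 2) : ℝ)) * M ^ (n - 1) :=
          mul_le_mul hxi hrest (Finset.prod_nonneg fun _ _ => norm_nonneg _) (by positivity)
      _ = M ^ n * (1 + |x i|) ^ (-(3 / 2) : ℝ) := by
          rw [← mul_pow_sub_one (by omega : n ≠ 0) M]
          ring
      _ ≤ _ := mul_le_mul_of_nonneg_left hmono (by positivity)
  · calc _ ≤ ∏ _j : Fin n, M * (1 + ‖z‖) ^ (-(1 / 2) : ℝ) :=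
          Finset.prod_le_prod (fun _ _ => norm_nonneg _) (fun j _ => hdisp j)
      _ = M ^ n * ((1 + ‖z‖) ^ (-(1 / 2) : ℝ)) ^ n := by simp [mul_pow]
      _ ≤ M ^ n * ((1 + ‖z‖) ^ (-(1 / 2) : ℝ)) ^ 3 :=
          mul_le_mul_of_nonneg_left (pow_le_pow_of_le_one (by positivity) hdecay hn) (by positivity)
      _ = M ^ n * (1 + ‖z‖) ^ (-(3 / 2) : ℝ) := by
          rw [← Real.rpow_mul_natCast (by positivity)]; norm_num
      _ ≤ _ := by
          refine mul_le_mul_of_nonneg_left ?_ (by positivity)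
          refine Real.rpow_le_rpow_of_nonpos (by positivity) ?_ (by norm_num)
          rw [add_le_add_iff_left, div_le_iff₀ hL0, mul_comm]
          exact h

theorem norm_e (a : ℝ) : ‖e a‖ = 1 := by
  rw [e, mul_comm, Complex.norm_exp_ofReal_mul_I]

theorem continuous_e : Continuous e := by unfold e; fun_prop

theorem e_mul_exp_eq_prod_oscGauss {n : ℕ} (ν t : ℝ) (x ξ : Fin n → ℝ) :
    e ((∑ j, x j * ξ j) - t * (∑ j, ξ j ^ 2)) *
        (Real.exp (-(ν * t * (∑ j, ξ j ^ 2))) : ℂ) =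
      ∏ j, oscGauss ((ν * t : ℝ) + t * Complex.I) (x j) (ξ j) := by
  simp only [e, oscGauss, ← Complex.exp_add, ← Complex.exp_sum, Complex.ofReal_exp]
  congr 1
  push_cast
  simp only [Finset.mul_sum, mul_sub, ← Finset.sum_sub_distrib, ← Finset.sum_neg_distrib,
    ← Finset.sum_add_distrib]
  exact Finset.sum_congr rfl fun j _ => by ring

/-- `G_ν(t)u` is the convolution of `u` with a product of one-dimensional kernels. -/
theorem Gnu_eq_integral_prod_cutoffKernel {n : ℕ} {ν t : ℝ} (hν : 0 ≤ ν) (ht : 0 ≤ t)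
    {k : Fin n → ℝ} {u : (Fin n → ℝ) → ℂ} (hu : Integrable u)
    (hsupp : ∀ ξ : Fin n → ℝ, (∃ j, 1 < |ξ j - k j|) → FT u ξ = 0)
    {φ : 𝓢(ℝ, ℂ)} (hφ : ∀ ξ : ℝ, |ξ| ≤ 1 → φ ξ = 1) (x : Fin n → ℝ) :
    Gnu ν u t x = ((2 * Real.pi) ^ n)⁻¹ • ∫ y : Fin n → ℝ,
      (∏ j, cutoffKernel φ (k j) ((ν * t : ℝ) + t * Complex.I) (x j - y j)) * u y := by
  set z : ℂ := (ν * t : ℝ) + t * Complex.I with hz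
  have hzre : 0 ≤ z.re := by
    rw [hz]; simpa using mul_nonneg hν ht
  set g : (Fin n → ℝ) → ℂ := fun ξ => ∏ j, oscGauss z (x j) (ξ j) * φ (ξ j - k j) with hg
  have hgi : Integrable g := Integrable.fintype_prod
    (f := fun j ξ => oscGauss z (x j) ξ * φ (ξ - k j)) fun j =>
    integrable_oscGauss_mul hzre (x j) (φ.integrable.comp_sub_right (k j))
  set F : (Fin n → ℝ) → (Fin n → ℝ) → ℂ := fun ξ y => g ξ * (e (-(∑ j, y j * ξ j)) * u y) with hF
  have hint : Integrable (Function.uncurry F) (volume.prod volume) := by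
    have h := (hgi.mul_prod hu).bdd_mul (c := 1)
      (f := fun p : (Fin n → ℝ) × (Fin n → ℝ) => e (-(∑ j, p.2 j * p.1 j)))
      (Continuous.aestronglyMeasurable (continuous_e.comp (by fun_prop)))
      (.of_forall fun p => (norm_e _).le)
    refine h.congr (.of_forall fun p => ?_)
    simp only [hF, Function.uncurry]
    ring
  have hcut : ∀ ξ : Fin n → ℝ, e ((∑ j, x j * ξ j) - t * (∑ j, ξ j ^ 2)) *
      (Real.exp (-(ν * t * (∑ j, ξ j ^ 2))) : ℂ) * FT u ξ = ∫ y, F ξ y := fun ξ => by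
    rw [e_mul_exp_eq_prod_oscGauss, hF, integral_const_mul]
    change _ = g ξ * FT u ξ
    by_cases h : ∃ j, 1 < |ξ j - k j|
    · rw [hsupp ξ h, mul_zero, mul_zero]
    · push Not at h
      simp only [hg, ← hz, hφ _ (h _), mul_one]
  have hshift : ∀ y : Fin n → ℝ, ∀ ξ : Fin n → ℝ, F ξ y =
      (∏ j, oscGauss z (x j - y j) (ξ j) * φ (ξ j - k j)) * u y := fun y ξ => by
    have he : e (-(∑ j, y j * ξ j)) = ∏ j, Complex.exp (Complex.I * ((-y j : ℝ) : ℂ) * ξ j) := by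
      rw [e, ← Complex.exp_sum]
      congr 1
      push_cast
      rw [← Finset.sum_neg_distrib, Finset.mul_sum]
      exact Finset.sum_congr rfl fun j _ => by ring
    simp only [hF, hg]
    rw [he, ← mul_assoc, ← Finset.prod_mul_distrib]
    congr 1
    refine Finset.prod_congr rfl fun j _ => ?_
    have : Complex.exp (Complex.I * ((x j - y j : ℝ) : ℂ) * ξ j) =
        Complex.exp (Complex.I * x j * ξ j) * Complex.exp (Complex.I * ((-y j : ℝ) : ℂ) * ξ j) := by
      rw [← Complex.exp_add]
      congr 1
      push_cast
      ring
    rw [oscGauss, oscGauss, this]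
    ring
  rw [Gnu]
  simp_rw [hcut]
  rw [integral_integral_swap hint]
  simp_rw [hshift]
  congr 2 with y
  rw [integral_mul_const, integral_fintype_prod_volume_eq_prod
    (f := fun j ξ => oscGauss z (x j - y j) ξ * φ (ξ - k j))]
  rfl

/-- maximal function estimate in dimension `n ≥ 3`,
`‖G_ν(t)u₀‖_{L¹_{x_i} L^∞_{x̄} L^∞_{t≥0}} ≤ C (1+|k_i|) ‖u₀‖_{L¹(ℝⁿ)}`, uniform in
`ν ≥ 0`, for `u₀ ∈ L¹(ℝⁿ)` with `𝓕u₀` supported in the unit cube around `k ∈ ℤⁿ`. -/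
theorem stmt_15 (n : ℕ) (hn : 3 ≤ n) (i : Fin n) :
    ∃ C : ℝ, 0 < C ∧
      ∀ (ν : ℝ), 0 ≤ ν →
      ∀ (k : Fin n → ℤ),
      ∀ u₀ : (Fin n → ℝ) → ℂ,
        Integrable u₀ →
        (∀ ξ : Fin n → ℝ, (∃ j, 1 < |ξ j - (k j : ℝ)|) → FT u₀ ξ = 0) →
        (∫ a : ℝ,
            ⨆ (t : ℝ) (_ : 0 ≤ t) (y : {j : Fin n // j ≠ i} → ℝ),
              ‖Gnu ν u₀ t (embed i a y)‖)
          ≤ C * (1 + |(k i : ℝ)|) * ∫ y : Fin n → ℝ, ‖u₀ y‖ := by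
  obtain ⟨φ, hφ1, hφ0⟩ := exists_schwartzMap_cutoff
  obtain ⟨A, hA0, hA⟩ := exists_norm_prod_cutoffKernel_le hn i φ hφ0
  set I : ℝ := ∫ a : ℝ, (1 + |a|) ^ (-(3 / 2) : ℝ) with hI
  have hI0 : 0 ≤ I := integral_nonneg fun _ => by positivity
  have hwi : Integrable fun a : ℝ => (1 + |a|) ^ (-(3 / 2) : ℝ) :=
    integrable_one_add_norm (E := ℝ) (by norm_num)
  refine ⟨((2 * Real.pi) ^ n)⁻¹ * A * 12 * I + 1, by positivity, ?_⟩
  intro ν hν k u₀ hu hsupp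
  set L : ℝ := 12 * (1 + |(k i : ℝ)|) with hL
  have hL0 : 0 < L := by positivity
  set W : ℝ → ℝ := fun a => ((2 * Real.pi) ^ n)⁻¹ * (A * (1 + |a / L|) ^ (-(3 / 2) : ℝ)) with hW
  have hW0 : ∀ a, 0 ≤ W a := fun a => by positivity
  have hWc : Continuous W := by
    refine continuous_const.mul (continuous_const.mul ?_)
    refine Continuous.rpow_const (by fun_prop) fun a => Or.inl ?_
    positivity
  have hWi : Integrable W := ((hwi.comp_div hL0.ne').const_mul A).const_mul _
  have hWint : ∫ a, W a = ((2 * Real.pi) ^ n)⁻¹ * (A * (L * I)) := by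
    rw [hW, integral_const_mul, integral_const_mul,
      Measure.integral_comp_div (fun a : ℝ => (1 + |a|) ^ (-(3 / 2) : ℝ)), abs_of_pos hL0,
      smul_eq_mul]
  have hprod : Integrable (Function.uncurry fun (a : ℝ) (y : Fin n → ℝ) => W (a - y i) * ‖u₀ y‖)
      (volume.prod volume) := by
    refine (integrable_prod_iff' ?_).2 ⟨.of_forall fun y => ?_, ?_⟩
    · refine AEStronglyMeasurable.mul ?_ hu.norm.aestronglyMeasurable.comp_snd
      exact Continuous.aestronglyMeasurable (hWc.comp (by fun_prop))
    · exact (hWi.comp_sub_right (y i)).mul_const ‖u₀ y‖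
    · have : ∀ y : Fin n → ℝ, ∫ a, ‖Function.uncurry
          (fun (a : ℝ) (y : Fin n → ℝ) => W (a - y i) * ‖u₀ y‖) (a, y)‖ =
          (∫ a, W a) * ‖u₀ y‖ := fun y => by
        simp only [Function.uncurry, norm_mul, norm_norm, Real.norm_of_nonneg (hW0 _)]
        rw [integral_mul_const, integral_sub_right_eq_self W]
      simp_rw [this]
      exact hu.norm.const_mul _
  have hpoint : ∀ (a t : ℝ), 0 ≤ t → ∀ y : {j : Fin n // j ≠ i} → ℝ,
      ‖Gnu ν u₀ t (embed i a y)‖ ≤ ∫ v : Fin n → ℝ, W (a - v i) * ‖u₀ v‖ := by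
    intro a t ht y
    rw [Gnu_eq_integral_prod_cutoffKernel (k := fun j => (k j : ℝ)) hν ht hu hsupp hφ1, norm_smul,
      Real.norm_of_nonneg (by positivity)]
    have hWu : Integrable fun v : Fin n → ℝ =>
        (A * (1 + |(a - v i) / L|) ^ (-(3 / 2) : ℝ)) * ‖u₀ v‖ := by
      refine hu.norm.bdd_mul (c := A) ?_ (.of_forall fun v => ?_)
      · refine Continuous.aestronglyMeasurable (continuous_const.mul ?_)
        refine Continuous.rpow_const (by fun_prop) fun v => Or.inl ?_
        positivity
      · rw [Real.norm_of_nonneg (by positivity)]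
        refine mul_le_of_le_one_right hA0.le (Real.rpow_le_one_of_one_le_of_nonpos ?_ (by norm_num))
        linarith [abs_nonneg ((a - v i) / L)]
    simp only [hW, mul_assoc]
    rw [integral_const_mul]
    simp only [← mul_assoc]
    refine mul_le_mul_of_nonneg_left ?_ (by positivity)
    refine norm_integral_le_of_norm_le hWu (.of_forall fun v => ?_)
    rw [norm_mul]
    refine mul_le_mul_of_nonneg_right ?_ (norm_nonneg _)
    have h := hA (fun j => (k j : ℝ)) ((ν * t : ℝ) + t * Complex.I)
      (by simpa using mul_nonneg hν ht) (fun j => embed i a y j - v j)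
    simpa [embed] using h
  have hnonneg : ∀ a : ℝ, 0 ≤ ∫ v : Fin n → ℝ, W (a - v i) * ‖u₀ v‖ := fun a =>
    integral_nonneg fun v => mul_nonneg (hW0 _) (norm_nonneg _)
  calc _ ≤ ∫ a : ℝ, ∫ v : Fin n → ℝ, W (a - v i) * ‖u₀ v‖ := by
        refine integral_mono_of_nonneg (.of_forall fun a => ?_) hprod.integral_prod_left
          (.of_forall fun a => ?_)
        · exact Real.iSup_nonneg fun t => Real.iSup_nonneg fun _ => Real.iSup_nonneg fun y =>
            norm_nonneg _
        · exact Real.iSup_le (fun t => Real.iSup_le (fun ht => Real.iSup_le (hpoint a t ht)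
            (hnonneg a)) (hnonneg a)) (hnonneg a)
    _ = (∫ a, W a) * ∫ y, ‖u₀ y‖ := by
        rw [integral_integral_swap hprod, ← integral_const_mul]
        congr 1 with y
        rw [integral_mul_const, integral_sub_right_eq_self W]
    _ ≤ _ := by
        refine mul_le_mul_of_nonneg_right ?_ (integral_nonneg fun _ => norm_nonneg _)
        rw [hWint, hL]
        nlinarith [abs_nonneg (k i : ℝ)]
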